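/- For integers 2 ≤ a ≤ b, let G be a connected finite simple graph of order n ≥ 4a + 5b/2 + 11 with minimum degree δ(G) ≥ a + 1. If the number of edges satisfies e(G) ≥ C(n−b−1, 2) + ab + 2a + b + 1, then G is a fractional [a,b]-covered graph. -/

import Mathlib

open Finset

/-- A fractional `[a,b]`-factor of `G`: a function `h` on (potential) edges taking values
in `[0,1]` on edges of `G`, such that for every vertex `u` the total weight of edges of `G`
incident with `u` lies between `a` and `b`. -/
def SimpleGraph.IsFracFactor {V : Type*} [Fintype V] [DecidableEq V]
    (G : SimpleGraph V) [DecidableRel G.Adj] (a b : ℕ) (h : Sym2 V → ℝ) : Prop :=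
  (∀ e ∈ G.edgeSet, 0 ≤ h e ∧ h e ≤ 1) ∧
  ∀ u : V, (a : ℝ) ≤ ∑ e ∈ G.incidenceFinset u, h e ∧
    ∑ e ∈ G.incidenceFinset u, h e ≤ (b : ℝ)

/-- `G` is fractional `(a,b,m)`-covered: for every set `M` of `m` edges of `G` there is a
fractional `[a,b]`-factor `h` of `G` with `h e = 1` for all `e ∈ M`. -/
def SimpleGraph.IsFracABMCovered {V : Type*} [Fintype V] [DecidableEq V]
    (G : SimpleGraph V) [DecidableRel G.Adj] (a b m : ℕ) : Prop :=
  ∀ M : Finset (Sym2 V), ↑M ⊆ G.edgeSet → M.card = m →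
    ∃ h : Sym2 V → ℝ, G.IsFracFactor a b h ∧ ∀ e ∈ M, h e = 1

/-- `G` is fractional `[a,b]`-covered: for every edge `e` of `G` there is a fractional
`[a,b]`-factor `h` of `G` with `h e = 1`. -/
def SimpleGraph.IsFracABCovered {V : Type*} [Fintype V] [DecidableEq V]
    (G : SimpleGraph V) [DecidableRel G.Adj] (a b : ℕ) : Prop :=
  ∀ e ∈ G.edgeSet, ∃ h : Sym2 V → ℝ, G.IsFracFactor a b h ∧ h e = 1

/-- The support-function gap between the vertex sums of the weightings `x` with `L ≤ x ≤ U`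
and the box `[a, b]^V`, in direction `c` (scaled by `2`). -/
noncomputable def dualGap {V : Type*} [Fintype V] (L U : V → V → ℝ) (a b : ℝ) (c : V → ℝ) : ℝ :=
  (∑ u, ∑ v, (U u v * max (c u + c v) 0 + L u v * min (c u + c v) 0)) -
    2 * ∑ u, (a * max (c u) 0 + b * min (c u) 0)

/-- If the gap is nonnegative on all vectors with entries in `{-1, 0, 1}`, it is nonnegative
everywhere: it is additive when the smallest nonzero absolute value is peeled off a vector. -/
theorem dualGap_nonneg_of_sign {V : Type*} [Fintype V] (L U : V → V → ℝ) (a b : ℝ)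
    (h : ∀ c : V → ℝ, (∀ u, c u = -1 ∨ c u = 0 ∨ c u = 1) → 0 ≤ dualGap L U a b c)
    (c : V → ℝ) : 0 ≤ dualGap L U a b c := by
  classical
  induction hk : (univ.filter fun u => c u ≠ 0).card using Nat.strong_induction_on
    generalizing c with
  | _ k ih =>
    obtain hs | hs := (univ.filter fun u => c u ≠ 0).eq_empty_or_nonempty
    · refine h c fun u => Or.inr (Or.inl ?_)
      by_contra hu
      have : u ∈ univ.filter fun u => c u ≠ 0 := by simp [hu]
      simp [hs] at this
    obtain ⟨w, hw, hmin⟩ := exists_min_image _ (fun u => |c u|) hs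
    simp only [mem_filter, mem_univ, true_and] at hw hmin
    set m := |c w| with hm
    have hmpos : 0 < m := abs_pos.2 hw
    let σ : V → ℝ := fun u => if 0 < c u then 1 else if c u < 0 then -1 else 0
    let c' : V → ℝ := fun u => c u - m * σ u
    have key : ∀ u, (0 < c u ∧ σ u = 1 ∧ c' u = c u - m ∧ m ≤ c u) ∨
        (c u = 0 ∧ σ u = 0 ∧ c' u = 0) ∨ (c u < 0 ∧ σ u = -1 ∧ c' u = c u + m ∧ m ≤ -c u) := by
      intro u
      rcases lt_trichotomy (c u) 0 with hu | hu | hu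
      · right; right
        have := hmin u hu.ne
        rw [abs_of_neg hu] at this
        simp [c', σ, hu, hu.not_gt, this]
      · right; left; simp [c', σ, hu]
      · left
        have := hmin u hu.ne'
        rw [abs_of_pos hu] at this
        simp [c', σ, hu, this]
    have hσ : 0 ≤ dualGap L U a b σ := by
      refine h σ fun u => ?_
      rcases key u with hu | hu | hu <;> simp [hu.2.1]
    have hcard : (univ.filter fun u => c' u ≠ 0).card < k := by
      rw [← hk]
      refine card_lt_card ⟨fun u => ?_, fun hsub => ?_⟩
      · simp only [mem_filter, mem_univ, true_and]
        intro hu hc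
        rcases key u with h1 | h1 | h1
        · linarith [h1.1]
        · exact hu h1.2.2
        · linarith [h1.1]
      · have : w ∈ univ.filter fun u => c' u ≠ 0 := hsub (by simp [hw])
        simp only [mem_filter, mem_univ, true_and] at this
        rcases key w with h1 | h1 | h1
        · rw [h1.2.2.1, hm, abs_of_pos h1.1] at this; simp at this
        · exact hw h1.1
        · rw [h1.2.2.1, hm, abs_of_neg h1.1] at this; simp at this
    have hc' := ih _ hcard c' rfl
    have hmax : ∀ u v, max (c u + c v) 0 = max (c' u + c' v) 0 + m * max (σ u + σ v) 0 := by
      intro u v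
      rcases key u with ⟨h1, h2, h3, h4⟩ | ⟨h1, h2, h3⟩ | ⟨h1, h2, h3, h4⟩ <;>
      rcases key v with ⟨k1, k2, k3, k4⟩ | ⟨k1, k2, k3⟩ | ⟨k1, k2, k3, k4⟩ <;>
      rw [h2, k2, h3, k3] <;> grind
    have hmin : ∀ u v, min (c u + c v) 0 = min (c' u + c' v) 0 + m * min (σ u + σ v) 0 := by
      intro u v
      rcases key u with ⟨h1, h2, h3, h4⟩ | ⟨h1, h2, h3⟩ | ⟨h1, h2, h3, h4⟩ <;>
      rcases key v with ⟨k1, k2, k3, k4⟩ | ⟨k1, k2, k3⟩ | ⟨k1, k2, k3, k4⟩ <;>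
      rw [h2, k2, h3, k3] <;> grind
    have hmax1 : ∀ u, max (c u) 0 = max (c' u) 0 + m * max (σ u) 0 := by
      intro u
      rcases key u with ⟨h1, h2, h3, h4⟩ | ⟨h1, h2, h3⟩ | ⟨h1, h2, h3, h4⟩ <;>
      rw [h2, h3] <;> grind
    have hmin1 : ∀ u, min (c u) 0 = min (c' u) 0 + m * min (σ u) 0 := by
      intro u
      rcases key u with ⟨h1, h2, h3, h4⟩ | ⟨h1, h2, h3⟩ | ⟨h1, h2, h3, h4⟩ <;>
      rw [h2, h3] <;> grind
    have hadd : dualGap L U a b c = dualGap L U a b c' + m * dualGap L U a b σ := by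
      simp only [dualGap, hmax, hmin, hmax1, hmin1, mul_sub, mul_sum, ← sum_add_distrib, mul_add,
        sub_add_sub_comm]
      congr 1
      · refine sum_congr rfl fun u _ => sum_congr rfl fun v _ => by ring
      · refine sum_congr rfl fun u _ => by ring
    rw [hadd]
    positivity

/-- If the gap is nonnegative in every direction, then a weighting between `L` and `U` has all
its symmetrized vertex sums in `[a, b]`. -/
theorem exists_weighting_of_dualGap_nonneg {V : Type*} [Fintype V] (L U : V → V → ℝ) (a b : ℝ)
    (hLU : L ≤ U) (hab : a ≤ b) (h : ∀ c : V → ℝ, 0 ≤ dualGap L U a b c) :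
    ∃ x ∈ Set.Icc L U, ∀ u, a ≤ ∑ v, (x u v + x v u) / 2 ∧ ∑ v, (x u v + x v u) / 2 ≤ b := by
  classical
  let D : (V → V → ℝ) →ₗ[ℝ] (V → ℝ) :=
    { toFun := fun x u => ∑ v, (x u v + x v u) / 2
      map_add' := fun x y => by
        ext u
        simp only [Pi.add_apply, ← sum_add_distrib]
        exact sum_congr rfl fun v _ => by ring
      map_smul' := fun r x => by
        ext u
        simp only [Pi.smul_apply, smul_eq_mul, mul_sum, RingHom.id_apply]
        exact sum_congr rfl fun v _ => by ring }
  have hD : ∀ x u, D x u = ∑ v, (x u v + x v u) / 2 := fun _ _ => rfl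
  by_contra! hne
  have hdisj : Disjoint (D '' Set.Icc L U) (Set.Icc (fun _ => a) (fun _ => b)) := by
    rw [Set.disjoint_left]
    rintro _ ⟨x, hx, rfl⟩ ⟨h1, h2⟩
    obtain ⟨u, hu⟩ := hne x hx
    exact absurd (hu (h1 u)) (not_lt.2 (h2 u))
  have hcomp : IsCompact (Set.Icc L U) := by
    have : Set.Icc L U = Set.univ.pi fun u => Set.univ.pi fun v => Set.Icc (L u v) (U u v) := by
      ext x
      simp [Pi.le_def]
    rw [this]
    exact isCompact_univ_pi fun u => isCompact_univ_pi fun v => isCompact_Icc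
  obtain ⟨f, s, t, hs, hst, ht⟩ := geometric_hahn_banach_compact_closed
    ((convex_Icc L U).linear_image D) (hcomp.image D.continuous_of_finiteDimensional)
    (convex_Icc (fun _ : V => a) (fun _ => b)) isClosed_Icc hdisj
  let c : V → ℝ := fun u => f (Pi.single u 1)
  have hf : ∀ y, f y = ∑ u, y u * c u := by
    intro y
    conv_lhs => rw [pi_eq_sum_univ' y]
    simp only [map_sum, map_smul, smul_eq_mul, c]
  let x : V → V → ℝ := fun u v => if 0 ≤ c u + c v then U u v else L u v
  let y : V → ℝ := fun u => if 0 ≤ c u then a else b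
  have hx : x ∈ Set.Icc L U := by
    refine ⟨fun u v => ?_, fun u v => ?_⟩ <;> dsimp only [x] <;> split_ifs <;>
      first | exact le_rfl | exact hLU u v
  have hy : y ∈ Set.Icc (fun _ => a) (fun _ => b) := by
    refine ⟨fun u => ?_, fun u => ?_⟩ <;> dsimp only [y] <;> split_ifs <;>
      first | exact le_rfl | exact hab
  have hlt : f (D x) < f y := (hs _ ⟨x, hx, rfl⟩).trans (hst.trans (ht y hy))
  have hDx : 2 * f (D x) = ∑ u, ∑ v, x u v * (c u + c v) := by
    have h1 : ∑ u, ∑ v, x v u * c u = ∑ u, ∑ v, x u v * c v := sum_comm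
    have h2 : 2 * f (D x) = ∑ u, ∑ v, x u v * c u + ∑ u, ∑ v, x v u * c u := by
      rw [hf, mul_sum, ← sum_add_distrib]
      refine sum_congr rfl fun u _ => ?_
      rw [hD, sum_mul, mul_sum, ← sum_add_distrib]
      refine sum_congr rfl fun v _ => by ring
    rw [h2, h1, ← sum_add_distrib]
    refine sum_congr rfl fun u _ => ?_
    rw [← sum_add_distrib]
    exact sum_congr rfl fun v _ => by ring
  have hgap : dualGap L U a b c = 2 * f (D x) - 2 * f y := by
    rw [hDx, hf, dualGap]
    congr 1
    · refine sum_congr rfl fun u _ => sum_congr rfl fun v _ => ?_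
      dsimp only [x]
      split_ifs with h0
      · simp [h0]
      · simp [(not_le.1 h0).le]
    · refine congrArg (2 * ·) (sum_congr rfl fun u _ => ?_)
      dsimp only [y]
      split_ifs with h0
      · simp [h0]
      · simp [(not_le.1 h0).le]
  linarith [h c]

namespace SimpleGraph

variable {V : Type*} [Fintype V] [DecidableEq V] (G : SimpleGraph V) [DecidableRel G.Adj]

theorem sum_incidenceFinset_eq_sum_neighborFinset (h : Sym2 V → ℝ) (u : V) :
    ∑ e ∈ G.incidenceFinset u, h e = ∑ v ∈ G.neighborFinset u, h s(u, v) := by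
  symm
  refine sum_bij (fun v _ => s(u, v)) ?_ ?_ ?_ ?_
  · intro v hv
    simpa [mk'_mem_incidenceSet_iff] using hv
  · intro v _ w _ hvw
    exact Sym2.congr_right.1 hvw
  · intro e he
    rw [mem_incidenceFinset] at he
    obtain ⟨v, rfl⟩ := Sym2.mem_iff_exists.1 he.2
    exact ⟨v, by simpa using he.1, rfl⟩
  · intros; rfl

/-- If `b|S| + d_{G-S}(T) - a|T|` is nonnegative for all disjoint `S`, `T`, and at least `2` when
`S` is nonempty, then `G` is fractional `[a,b]`-covered. -/
theorem isFracABCovered_of_le {a b : ℕ} (hab : a ≤ b)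
    (h₀ : ∀ T : Finset V, a * T.card ≤ ∑ u ∈ T, G.degree u)
    (h : ∀ S T : Finset V, Disjoint S T → S.Nonempty →
      a * T.card + 2 ≤ b * S.card + ∑ u ∈ T, (G.neighborFinset u \ S).card) :
    G.IsFracABCovered a b := by
  intro e₀ he₀
  induction e₀ with | _ p q =>
  rw [mem_edgeSet] at he₀
  let U : V → V → ℝ := fun u v => if G.Adj u v then 1 else 0
  let L : V → V → ℝ := fun u v => if s(u, v) = s(p, q) then 1 else 0
  have hLU : L ≤ U := by
    intro u v
    dsimp only [L, U]
    split_ifs with h1 h2 h2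
    · exact le_rfl
    · exact absurd ((mem_edgeSet G).1 (h1 ▸ (mem_edgeSet G).2 he₀)) h2
    · exact zero_le_one
    · exact le_rfl
  obtain ⟨x, ⟨hLx, hxU⟩, hx⟩ := exists_weighting_of_dualGap_nonneg L U a b hLU
      (by exact_mod_cast hab) (dualGap_nonneg_of_sign L U a b fun c hc => by
    set T : Finset V := univ.filter fun u => c u = 1 with hT
    set S : Finset V := univ.filter fun u => c u = -1 with hS
    have hdisj : Disjoint S T := by
      rw [Finset.disjoint_left]
      intro u h1 h2
      simp only [hS, hT, mem_filter, mem_univ, true_and] at h1 h2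
      linarith
    have hdeg : ∑ u, ∑ v, U u v * max (c u + c v) 0 =
        2 * ∑ u ∈ T, ((G.neighborFinset u \ S).card : ℝ) := by
      have h1 : ∀ u v, max (c u + c v) 0 = (if c u = 1 ∧ c v ≠ -1 then 1 else 0) +
          (if c v = 1 ∧ c u ≠ -1 then 1 else 0) := by
        intro u v
        rcases hc u with h | h | h <;> rcases hc v with k | k | k <;> rw [h, k] <;> norm_num
      have h2 : ∑ u, ∑ v, U u v * (if c u = 1 ∧ c v ≠ -1 then 1 else 0) =
          ∑ u ∈ T, ((G.neighborFinset u \ S).card : ℝ) := by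
        rw [hT, sum_filter]
        refine sum_congr rfl fun u _ => ?_
        split_ifs with hu
        · have h3 : ((G.neighborFinset u \ S).card : ℝ) =
              ∑ v, if v ∈ G.neighborFinset u \ S then 1 else 0 := by
            rw [sum_boole, filter_mem_eq_inter, univ_inter]
          rw [h3]
          refine sum_congr rfl fun v _ => ?_
          by_cases hv : G.Adj u v <;> simp [U, hS, hu, hv]
        · simp [hu]
      have h3 : ∑ u, ∑ v, U u v * (if c v = 1 ∧ c u ≠ -1 then (1 : ℝ) else 0) =
          ∑ u, ∑ v, U u v * (if c u = 1 ∧ c v ≠ -1 then 1 else 0) := by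
        rw [sum_comm]
        refine sum_congr rfl fun u _ => sum_congr rfl fun v _ => ?_
        simp only [U, G.adj_comm]
      simp only [h1, mul_add, sum_add_distrib]
      rw [h3, h2]
      ring
    have hlow : ∑ u, ∑ v, L u v * min (c u + c v) 0 = 2 * min (c p + c q) 0 := by
      have hL : ∀ u v, L u v = (if u = p then 1 else 0) * (if v = q then 1 else 0) +
          (if u = q then 1 else 0) * (if v = p then 1 else 0) := by
        intro u v
        have := he₀.ne
        dsimp only [L]
        simp only [Sym2.eq_iff]
        grind
      simp only [hL, add_mul, sum_add_distrib, ite_mul, one_mul, zero_mul]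
      simp [add_comm (c q), two_mul]
    have hvert : ∑ u, (a * max (c u) 0 + b * min (c u) 0) = (a * T.card - b * S.card : ℝ) := by
      have h1 : ∀ u, (a * max (c u) 0 + b * min (c u) 0 : ℝ) =
          a * (if c u = 1 then 1 else 0) - b * (if c u = -1 then 1 else 0) := by
        intro u
        rcases hc u with h | h | h <;> rw [h] <;> norm_num
      simp only [h1, sum_sub_distrib, ← mul_sum, sum_boole, hT, hS]
    simp only [dualGap, sum_add_distrib] at hvert ⊢
    rw [hdeg, hlow, hvert]
    obtain hSe | hSe := S.eq_empty_or_nonempty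
    · have h1 : ∀ u, 0 ≤ c u := by
        intro u
        have : u ∉ S := by simp [hSe]
        rcases hc u with h | h | h
        · simp [hS, h] at this
        · simp [h]
        · simp [h]
      have h2 : (a * T.card : ℝ) ≤ ∑ u ∈ T, (G.degree u : ℝ) := by exact_mod_cast h₀ T
      rw [min_eq_right (add_nonneg (h1 p) (h1 q)), hSe]
      simp only [sdiff_empty, card_neighborFinset_eq_degree, card_empty]
      push_cast
      linarith
    · have h1 : (a * T.card + 2 : ℝ) ≤
          b * S.card + ∑ u ∈ T, ((G.neighborFinset u \ S).card : ℝ) := by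
        exact_mod_cast h S T hdisj hSe
      have h2 : -2 ≤ min (c p + c q) 0 := by
        have h3 : ∀ u, -1 ≤ c u := fun u => by rcases hc u with h | h | h <;> rw [h] <;> norm_num
        exact le_min (by linarith [h3 p, h3 q]) (by norm_num)
      linarith)
  have hx0 : ∀ u v, 0 ≤ x u v := fun u v =>
    le_trans (by dsimp only [L]; split_ifs <;> simp) (hLx u v)
  have hx1 : ∀ u v, x u v ≤ 1 := fun u v =>
    (hxU u v).trans (by dsimp only [U]; split_ifs <;> simp)
  have hxL : ∀ u v, s(u, v) = s(p, q) → x u v = 1 := fun u v huv =>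
    le_antisymm (hx1 u v) ((if_pos huv).symm.le.trans (hLx u v))
  refine ⟨Sym2.lift ⟨fun u v => (x u v + x v u) / 2, fun u v => by simp only [add_comm]⟩,
    ⟨fun e _ => ?_, fun u => ?_⟩, ?_⟩
  · induction e with | _ u v =>
    simp only [Sym2.lift_mk]
    constructor <;> linarith [hx0 u v, hx0 v u, hx1 u v, hx1 v u]
  · have : ∑ v ∈ G.neighborFinset u, (x u v + x v u) / 2 = ∑ v, (x u v + x v u) / 2 := by
      refine sum_subset (subset_univ _) fun v _ hv => ?_
      have hadj : ¬ G.Adj u v := by simpa using hv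
      have hadj' : ¬ G.Adj v u := fun h => hadj h.symm
      have h1 := hxU u v
      have h2 := hxU v u
      simp only [U, hadj, hadj', if_false] at h1 h2
      linarith [hx0 u v, hx0 v u]
    rw [sum_incidenceFinset_eq_sum_neighborFinset]
    simp only [Sym2.lift_mk]
    rw [this]
    exact hx u
  · simp only [Sym2.lift_mk]
    rw [hxL p q rfl, hxL q p Sym2.eq_swap]
    norm_num

theorem two_mul_card_edgeFinset_le (T : Finset V) :
    2 * G.edgeFinset.card ≤
      (Fintype.card V - T.card) * (Fintype.card V - T.card - 1) + 2 * ∑ u ∈ T, G.degree u := by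
  have hsplit : ∑ u ∈ Tᶜ, G.degree u =
      ∑ u ∈ Tᶜ, (G.neighborFinset u \ T).card + ∑ u ∈ Tᶜ, (G.neighborFinset u ∩ T).card := by
    rw [← sum_add_distrib]
    refine sum_congr rfl fun u _ => ?_
    rw [← card_neighborFinset_eq_degree, card_sdiff_add_card_inter]
  have hout : ∑ u ∈ Tᶜ, (G.neighborFinset u \ T).card ≤ Tᶜ.card * (Tᶜ.card - 1) := by
    rw [← smul_eq_mul]
    refine sum_le_card_nsmul _ _ _ fun u hu => ?_
    rw [← card_erase_of_mem hu]
    refine card_le_card fun v hv => ?_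
    simp only [mem_sdiff, mem_neighborFinset] at hv
    simp [hv.1.ne', hv.2]
  have hin : ∑ u ∈ Tᶜ, (G.neighborFinset u ∩ T).card ≤ ∑ u ∈ T, G.degree u := by
    have := sum_card_bipartiteAbove_eq_sum_card_bipartiteBelow (s := Tᶜ) (t := T) G.Adj
    calc ∑ u ∈ Tᶜ, (G.neighborFinset u ∩ T).card
        = ∑ u ∈ Tᶜ, (bipartiteAbove G.Adj T u).card := by
          refine sum_congr rfl fun u _ => congrArg card ?_
          ext v
          simp [bipartiteAbove, and_comm]
      _ = ∑ u ∈ T, (bipartiteBelow G.Adj Tᶜ u).card := this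
      _ ≤ ∑ u ∈ T, G.degree u := by
          refine sum_le_sum fun u _ => ?_
          rw [← card_neighborFinset_eq_degree]
          refine card_le_card fun v hv => ?_
          simp only [bipartiteBelow, mem_filter] at hv
          simpa using hv.2.symm
  rw [card_compl] at hout
  rw [← sum_degrees_eq_twice_card_edges, ← sum_add_sum_compl T]
  lia

end SimpleGraph

/-- The numerical incompatibility: a violating pair with `|S| = s`, `|T| = k + b + 1` in a graph on
`N + b + 1` vertices forces too few edges. -/
theorem edge_bound_contradiction {a b k s N : ℝ} (ha : 2 ≤ a) (hab : a ≤ b) (hk : k = 0 ∨ 1 ≤ k)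
    (hN : 8 * a + 3 * b + 20 ≤ 2 * N) (hs : b * s ≤ a * (k + b + 1) + 1) (hsN : s + k ≤ N)
    (he : k * N - k * (k + 1) / 2 ≤ (k + 1) * s + a * k - a - b) : False := by
  rcases hk with rfl | hk
  · nlinarith
  by_cases hc : 2 * a + 3 / 2 * k + 3 ≤ N
  · have h1 : (k + 1) * (b * s) ≤ (k + 1) * (a * (k + b + 1) + 1) :=
      mul_le_mul_of_nonneg_left hs (by linarith)
    have h2 : b * (k * N - k * (k + 1) / 2) ≤ b * ((k + 1) * s + a * k - a - b) :=
      mul_le_mul_of_nonneg_left he (by linarith)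
    have h3 : b * k * (2 * a + 3 / 2 * k + 3) ≤ b * k * N :=
      mul_le_mul_of_nonneg_left hc (by nlinarith)
    have h4 : (k + 1) ^ 2 * a ≤ (k + 1) ^ 2 * b := mul_le_mul_of_nonneg_left hab (by positivity)
    have h5 : (k + 1) * 2 ≤ (k + 1) * b := mul_le_mul_of_nonneg_left (by linarith) (by linarith)
    nlinarith
  · have h1 : (k + 1) * s ≤ (k + 1) * (N - k) :=
      mul_le_mul_of_nonneg_left (by linarith) (by linarith)
    have h2 : 2 * a + 4 ≤ k := by linarith
    nlinarith [mul_le_mul_of_nonneg_left h2 (by linarith : 0 ≤ k)]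

/-- A violating pair, with `s = |S|`, `t = |T|` and `d = d_{G-S}(T)`, is incompatible with the
bound on the number `m` of edges. -/
theorem counting_contradiction {a b n s t d m : ℕ} (ha : 2 ≤ a) (hab : a ≤ b)
    (hnb : 8 * a + 5 * b + 22 ≤ 2 * n) (hspos : 1 ≤ s) (hcard : s + t ≤ n)
    (hlt : b * s + d < a * t + 2) (hT : t * (a + 1) ≤ t * s + d)
    (he : (n - b - 1).choose 2 + a * b + 2 * a + b + 1 ≤ m)
    (hedge : 2 * m ≤ (n - t) * (n - t - 1) + 2 * (t * s + d)) : False := by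
  have htb : b + 1 ≤ t := by
    by_contra! htb
    obtain ht | ht : t = 0 ∨ t = 1 := by
      by_contra! ht
      have : 2 ≤ t := by lia
      obtain ⟨r, rfl⟩ : ∃ r, b = t + r := ⟨b - t, by lia⟩
      nlinarith
    · rw [ht] at hlt
      nlinarith
    · rw [ht] at hlt hT
      nlinarith
  obtain ⟨k, hk⟩ : ∃ k, t = b + 1 + k := ⟨t - (b + 1), by lia⟩
  obtain ⟨N, hN⟩ : ∃ N, n = N + b + 1 := ⟨n - (b + 1), by lia⟩
  obtain ⟨r, hr⟩ : ∃ r, N = k + r + 1 := ⟨N - k - 1, by lia⟩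
  rw [show n - b - 1 = k + r + 1 by lia] at he
  rw [show n - t = r + 1 by lia, Nat.add_sub_cancel] at hedge
  have heR : ((k + r + 1) * (k + r) / 2 + a * b + 2 * a + b + 1 : ℝ) ≤ m := by
    have := (Nat.cast_le (α := ℝ)).2 he
    have hch := Nat.cast_choose_two ℝ (k + r + 1)
    push_cast at this hch
    rw [hch] at this
    linarith
  have hedgeR : (2 * m : ℝ) ≤ (r + 1) * r + 2 * (t * s + d) := by
    exact_mod_cast hedge
  have hltR : (b * s + d + 1 : ℝ) ≤ a * t + 2 := by exact_mod_cast hlt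
  have htR : (t : ℝ) = b + 1 + k := by exact_mod_cast hk
  rw [htR] at hedgeR hltR
  refine edge_bound_contradiction (a := a) (b := b) (k := k) (s := s) (N := k + r + 1)
    (by exact_mod_cast ha) (by exact_mod_cast hab) ?_ ?_ ?_ ?_ ?_
  · rcases Nat.eq_zero_or_pos k with h | h
    · simp [h]
    · exact Or.inr (by exact_mod_cast h)
  · exact_mod_cast (by lia : 8 * a + 3 * b + 20 ≤ 2 * (k + r + 1))
  · have : (0 : ℝ) ≤ d := d.cast_nonneg
    linarith
  · exact_mod_cast (by lia : s + k ≤ k + r + 1)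
  · nlinarith

/-- size condition for a connected graph of large order and minimum degree at
least `a + 1` to be fractional `[a,b]`-covered. -/
theorem size_ge_implies_fracABCovered
    {V : Type*} [Fintype V] [DecidableEq V] (G : SimpleGraph V) [DecidableRel G.Adj]
    (a b : ℕ) (ha : 2 ≤ a) (hab : a ≤ b)
    (hconn : G.Connected)
    (hn : 4 * (a : ℝ) + 5 * (b : ℝ) / 2 + 11 ≤ (Fintype.card V : ℝ))
    (hδ : ∀ v : V, a + 1 ≤ G.degree v)
    (he : (Fintype.card V - b - 1).choose 2 + a * b + 2 * a + b + 1 ≤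
      G.edgeFinset.card) :
    G.IsFracABCovered a b := by
  refine G.isFracABCovered_of_le hab (fun T => ?_) fun S T hST hS => ?_
  · rw [mul_comm, ← smul_eq_mul]
    exact card_nsmul_le_sum _ _ _ fun u _ => (Nat.le_succ a).trans (hδ u)
  by_contra! hlt
  have hspos : 1 ≤ S.card := hS.card_pos
  have hcard : S.card + T.card ≤ Fintype.card V := by
    rw [← card_union_of_disjoint hST]
    exact card_le_univ _
  have hdegle : ∀ u, G.degree u ≤ S.card + (G.neighborFinset u \ S).card := fun u => by
    rw [← G.card_neighborFinset_eq_degree, ← card_sdiff_add_card_inter _ S]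
    have := card_le_card (inter_subset_right : G.neighborFinset u ∩ S ⊆ S)
    lia
  have hT : T.card * (a + 1) ≤ T.card * S.card + ∑ u ∈ T, (G.neighborFinset u \ S).card := by
    rw [← smul_eq_mul, ← smul_eq_mul, ← sum_const, ← sum_const, ← sum_add_distrib]
    exact sum_le_sum fun u _ => (hδ u).trans (hdegle u)
  have hdegT : ∑ u ∈ T, G.degree u ≤
      T.card * S.card + ∑ u ∈ T, (G.neighborFinset u \ S).card := by
    rw [← smul_eq_mul, ← sum_const, ← sum_add_distrib]
    exact sum_le_sum fun u _ => hdegle u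
  have hedge := G.two_mul_card_edgeFinset_le T
  have hnb : 8 * a + 5 * b + 22 ≤ 2 * Fintype.card V := by
    have : (8 * a + 5 * b + 22 : ℝ) ≤ 2 * Fintype.card V := by linarith
    exact_mod_cast this
  exact counting_contradiction ha hab hnb hspos hcard hlt hT he
    (hedge.trans (Nat.add_le_add_left (Nat.mul_le_mul_left 2 hdegT) _))
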